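/- Assume q is a positive real number with q ≠ 1. Then every α_q-derivation D of 𝔄_q that is homogeneous (even or odd) of some degree s ∈ ℤ is identically zero. -/

import Mathlib

open Finsupp

/-- Index type for the basis of the q-deformed Heisenberg-Virasoro superalgebra:
`L m, I m` (even), `G m, T m` (odd), for `m ∈ ℤ`. -/
inductive BIdx : Type
  | L : ℤ → BIdx
  | I : ℤ → BIdx
  | G : ℤ → BIdx
  | T : ℤ → BIdx
  deriving DecidableEq

/-- The underlying super vector space `𝔄_q`: the free `ℂ`-module on the basis `BIdx`. -/
abbrev Aq : Type := BIdx →₀ ℂ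

/-- Parity of the basis elements: `L, I` even (`false`), `G, T` odd (`true`). -/
def BIdx.parity : BIdx → Bool
  | .L _ => false
  | .I _ => false
  | .G _ => true
  | .T _ => true

/-- The `q`-number `{n} = (1 - qⁿ)/(1 - q)`. -/
noncomputable def qnum (q : ℂ) (n : ℤ) : ℂ := (1 - q ^ n) / (1 - q)

/-- The bracket `[·,·]_q` on basis elements (extended by super-skew-symmetry). -/
noncomputable def bk (q : ℂ) : BIdx → BIdx → Aq
  | .L m, .L n => single (.L (m + n)) (qnum q m - qnum q n)
  | .L m, .I n => single (.I (m + n)) (-(qnum q n))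
  | .I m, .L n => single (.I (m + n)) (qnum q m)
  | .L m, .G n => single (.G (m + n)) (qnum q m - qnum q (n + 1))
  | .G m, .L n => single (.G (m + n)) (qnum q (m + 1) - qnum q n)
  | .I m, .G n => single (.T (m + n)) (qnum q m)
  | .G m, .I n => single (.T (m + n)) (-(qnum q n))
  | .L m, .T n => single (.T (m + n)) (-(qnum q (n + 1)))
  | .T m, .L n => single (.T (m + n)) (qnum q (m + 1))
  | _, _ => 0

/-- Bilinear extension of the bracket `[·,·]_q` to all of `𝔄_q`. -/
noncomputable def bkA (q : ℂ) (x y : Aq) : Aq :=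
  x.sum fun i a => y.sum fun j b => (a * b) • bk q i j

/-- The eigenvalue of the twist map `α_q` on each basis element. -/
noncomputable def acoef (q : ℂ) : BIdx → ℂ
  | .L n => 1 + q ^ n
  | .I n => 1 + q ^ n
  | .G n => 1 + q ^ (n + 1)
  | .T n => 1 + q ^ (n + 1)

/-- The even linear twist map `α_q` of `𝔄_q`. -/
noncomputable def alq (q : ℂ) (x : Aq) : Aq :=
  x.sum fun i a => single i (acoef q i * a)

/-- `x` is homogeneous of parity `p`. -/
def homOf (p : Bool) (x : Aq) : Prop := ∀ i ∈ x.support, BIdx.parity i = p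

/-- The sign `(−1)^{|x||y|}` for parities `a`, `b`. -/
noncomputable def sgn (a b : Bool) : ℂ := if a && b then -1 else 1

/-- The span of the basis elements `L_n, I_n`. -/
noncomputable def spanLI (n : ℤ) : Submodule ℂ Aq :=
  Submodule.span ℂ {single (BIdx.L n) (1 : ℂ), single (BIdx.I n) (1 : ℂ)}

/-- The span of the basis elements `G_n, T_n`. -/
noncomputable def spanGT (n : ℤ) : Submodule ℂ Aq :=
  Submodule.span ℂ {single (BIdx.G n) (1 : ℂ), single (BIdx.T n) (1 : ℂ)}

/-- The linear extension of a map `D` given by its values on the basis. -/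
noncomputable def DA (D : BIdx → Aq) (x : Aq) : Aq := x.sum fun i a => a • D i

/-- The sign `(−1)^{|x|}` for a parity `b`. -/
noncomputable def sgn1 (b : Bool) : ℂ := if b then -1 else 1

/-- `D` (of parity `pD`) is homogeneous of degree `s`. -/
def HomogeneousOfDegree (pD : Bool) (s : ℤ) (D : BIdx → Aq) : Prop :=
  ∀ n : ℤ,
    D (.L n) ∈ (if pD then spanGT (n + s) else spanLI (n + s)) ∧
    D (.I n) ∈ (if pD then spanGT (n + s) else spanLI (n + s)) ∧
    D (.G n) ∈ (if pD then spanLI (n + s) else spanGT (n + s)) ∧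
    D (.T n) ∈ (if pD then spanLI (n + s) else spanGT (n + s))

/-- `D` (of parity `pD`) is an `α_q`-derivation:
`D([x,y]_q) = [D x, α_q y]_q + (−1)^{|x||D|}[α_q x, D y]_q` for homogeneous `x, y`. -/
def IsAlphaDerivation (q : ℂ) (pD : Bool) (D : BIdx → Aq) : Prop :=
  ∀ (px py : Bool) (x y : Aq), homOf px x → homOf py y →
    DA D (bkA q x y) = bkA q (DA D x) (alq q y) + sgn px pD • bkA q (alq q x) (DA D y)


section helpers

lemma aq_zpow_pos (q : ℂ) (r : ℝ) (hr : 0 < r) (hrq : (r : ℂ) = q) (n : ℤ) :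
    ∃ w : ℝ, 0 < w ∧ q ^ n = (w : ℂ) :=
  ⟨r ^ n, zpow_pos hr n, by rw [← hrq]; push_cast; rfl⟩

lemma aq_inj (q : ℂ) (r : ℝ) (hr : 0 < r) (hrq : (r : ℂ) = q) (hq1 : q ≠ 1) {m n : ℤ}
    (h : q ^ m = q ^ n) : m = n := by
  have h1 : r ≠ 1 := by
    rintro rfl; exact hq1 (by rw [← hrq]; simp)
  rw [← hrq] at h
  have h2 : r ^ m = r ^ n := by exact_mod_cast h
  exact zpow_right_injective₀ hr h1 h2

lemma aq_pos_ne (q : ℂ) (r : ℝ) (hr : 0 < r) (hrq : (r : ℂ) = q) (n : ℤ) (a b c : ℝ)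
    (ha : 0 ≤ a) (hb : 0 ≤ b) (hc : 0 < c) :
    (a * (q ^ n) ^ 2 + b * q ^ n + c : ℂ) ≠ 0 := by
  obtain ⟨w, hw, h⟩ := aq_zpow_pos q r hr hrq n
  rw [h]
  have : a * w ^ 2 + b * w + c ≠ 0 := by positivity
  exact_mod_cast this

lemma lemC (q : ℂ) (r : ℝ) (hr : 0 < r) (hrq : (r : ℂ) = q) (hq1 : q ≠ 1)
    (e σ δ δ' : ℤ) (hδ : 0 ≤ δ) (f : ℤ → ℂ)
    (h : ∀ m n : ℤ, (q ^ (n + e) - q ^ (δ * m)) * f (m + n)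
      = (1 + q ^ m) * (q ^ (n + σ) - q ^ (δ' * m)) * f n) (k : ℤ) : f k = 0 := by
  have hq0 : q ≠ 0 := by rw [← hrq]; exact_mod_cast hr.ne'
  by_contra hk
  have h0 : ∀ n, f n = 0 ∨ 1 + q ^ (n + e) - 2 * q ^ (n + σ) = 0 := by
    intro n
    have := h 0 n
    simp only [mul_zero, zpow_zero, zero_add] at this
    rw [← mul_eq_zero]
    linear_combination this
  have hk0 := (h0 k).resolve_left hk
  have hu : ∀ n, n ≠ k → f n = 0 := by
    intro n hn
    refine (h0 n).resolve_right fun h1 => hn ?_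
    apply aq_inj q r hr hrq hq1
    rw [zpow_add₀ hq0, zpow_add₀ hq0] at h1 hk0
    linear_combination q ^ n * hk0 - q ^ k * h1
  have h2 : ∀ m, m ≠ 0 → k + σ = δ' * m := by
    intro m hm
    have := h m k
    rw [hu (m + k) (by omega), mul_zero] at this
    have h3 : (1 + q ^ m : ℂ) ≠ 0 := by
      have := aq_pos_ne q r hr hrq m 0 1 1 le_rfl zero_le_one one_pos
      intro h; apply this; push_cast; linear_combination h
    have := this.symm
    simp only [mul_eq_zero, hk, h3, or_false, false_or] at this
    exact aq_inj q r hr hrq hq1 (sub_eq_zero.1 this)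
  have h21 := h2 1 (by norm_num)
  have h22 := h2 2 (by norm_num)
  have hks : k + σ = 0 := by omega
  rw [hks] at hk0
  have hke : k + e = 0 := by
    apply aq_inj q r hr hrq hq1
    simp only [zpow_zero] at hk0 ⊢
    linear_combination hk0
  have h4 := h 1 (k - 1)
  rw [hu (k - 1) (by omega), mul_zero, show 1 + (k - 1) = k by ring] at h4
  simp only [mul_eq_zero, hk, or_false] at h4
  have := aq_inj q r hr hrq hq1 (sub_eq_zero.1 h4)
  omega

lemma special_unique (q : ℂ) (r : ℝ) (hr : 0 < r) (hrq : (r : ℂ) = q) (hq1 : q ≠ 1)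
    (s : ℤ) (f : ℤ → ℂ) (h0 : ∀ n, f n * (1 + q ^ n - 2 * q ^ n * q ^ s) = 0)
    (k n : ℤ) (hk : f k ≠ 0) (hn : n ≠ k) : f n = 0 := by
  have hk0 := (mul_eq_zero.1 (h0 k)).resolve_left hk
  refine (mul_eq_zero.1 (h0 n)).resolve_right fun h1 => hn ?_
  apply aq_inj q r hr hrq hq1
  linear_combination q ^ n * hk0 - q ^ k * h1

lemma lemA (q : ℂ) (r : ℝ) (hr : 0 < r) (hrq : (r : ℂ) = q) (hq1 : q ≠ 1)
    (s : ℤ) (f : ℤ → ℂ)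
    (h : ∀ m n : ℤ, (q ^ n - q ^ m) * f (m + n)
      = (q ^ n - q ^ (m + s)) * (1 + q ^ n) * f m
        + (1 + q ^ m) * (q ^ (n + s) - q ^ m) * f n) (k : ℤ) : f k = 0 := by
  have hq0 : q ≠ 0 := by rw [← hrq]; exact_mod_cast hr.ne'
  have hu0 : q ^ s ≠ 0 := zpow_ne_zero _ hq0
  have hpos := aq_pos_ne q r hr hrq
  have hinj := fun {m n : ℤ} => @aq_inj q r hr hrq hq1 m n
  have h1 : ∀ n, f n * (1 + q ^ n - 2 * q ^ n * q ^ s) = f 0 * (q ^ n - q ^ s) * (1 + q ^ n) := by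
    intro n
    have := h 0 n
    simp only [zero_add, zpow_zero, zpow_add₀ hq0] at this
    linear_combination this
  have hf0 : f 0 = 0 := by
    by_cases hs : s = 0
    · subst hs
      have h2 : ∀ n, n ≠ 0 → f n = - f 0 * (1 + q ^ n) := by
        intro n hn
        have h3 : 1 - q ^ n ≠ 0 := fun h => hn (hinj (by rw [zpow_zero]; linear_combination -h))
        apply mul_right_cancel₀ h3
        have := h1 n
        simp only [zpow_zero] at this
        linear_combination this
      have h3 := h 1 2
      rw [h2 1 (by norm_num), h2 2 (by norm_num), h2 (1+2) (by norm_num)] at h3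
      have e3 : q ^ ((1:ℤ) + 2) = q ^ 3 := by norm_cast
      have e2 : q ^ (2:ℤ) = q ^ 2 := by norm_cast
      simp only [add_zero, e3, e2, zpow_one] at h3
      have h4 : q ^ 2 - q ≠ 0 := by
        intro h
        have : (2:ℤ) = 1 := hinj (by rw [e2, zpow_one]; linear_combination h)
        omega
      have h5 : (q^3 + 2 * q + 2 * q^2 + 1 : ℂ) ≠ 0 := by
        rw [← hrq]
        have : r^3 + 2 * r + 2 * r^2 + 1 ≠ 0 := by positivity
        exact_mod_cast this
      have h6 : f 0 * ((q ^ 2 - q) * (q^3 + 2 * q + 2 * q^2 + 1)) = 0 := by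
        linear_combination h3
      exact (mul_eq_zero.1 h6).resolve_right (mul_ne_zero h4 h5)
    · have hu1 : 1 - q ^ s ≠ 0 := fun h => hs (hinj (by rw [zpow_zero]; linear_combination -h))
      have hA := h1 s
      have hB := h1 (-s)
      have hC := h s (-s)
      simp only [zpow_add₀ hq0, zpow_neg, add_neg_cancel, neg_add_cancel, zpow_zero] at hA hB hC
      have p1 := hpos s 0 2 1 le_rfl (by norm_num) one_pos
      have p2 := hpos s 0 1 1 le_rfl (by norm_num) one_pos
      have p3 := hpos s 0 1 2 le_rfl (by norm_num) (by norm_num)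
      push_cast at p1 p2 p3
      generalize q ^ s = u at *
      have hfs : f s = 0 := by
        have : f s * ((1 - u) * (0 * u ^ 2 + 2 * u + 1)) = 0 := by linear_combination hA
        exact (mul_eq_zero.1 this).resolve_right (mul_ne_zero hu1 p1)
      rw [hfs] at hC
      field_simp at hB hC
      have hB' : f (-s) * u = f 0 * (1 + u) ^ 2 := by
        apply mul_left_cancel₀ hu1; linear_combination hB
      have hC' : f 0 = f (-s) * u := by
        apply mul_left_cancel₀ (mul_ne_zero hu0 (mul_ne_zero hu1 p2)); linear_combination hC
      have : f 0 * (u * (0 * u ^ 2 + 1 * u + 2)) = 0 := by linear_combination - hC' - hB'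
      exact (mul_eq_zero.1 this).resolve_right (mul_ne_zero hu0 p3)
  by_contra hk
  have hk0 : k ≠ 0 := by rintro rfl; exact hk hf0
  have hz := fun n hn => special_unique q r hr hrq hq1 s f
    (by intro n; rw [h1, hf0]; ring) k n hk hn
  obtain ⟨m, hm0, hmk, hms⟩ : ∃ m : ℤ, m ≠ 0 ∧ m ≠ k ∧ m ≠ k + s :=
    ⟨|k| + |k + s| + 1, by positivity, by
      have := le_abs_self k; have := abs_nonneg (k+s); omega, by
      have := le_abs_self (k+s); have := abs_nonneg k; omega⟩
  have h3 := h m k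
  rw [hz (m + k) (by omega), hz m hmk] at h3
  have p2 := hpos m 0 1 1 le_rfl (by norm_num) one_pos
  push_cast at p2
  have h4 : (0 * (q ^ m) ^ 2 + 1 * q ^ m + 1) * (q ^ (k + s) - q ^ m) * f k = 0 := by
    linear_combination -h3
  simp only [mul_eq_zero, hk, p2, or_false, false_or] at h4
  exact hms (hinj (sub_eq_zero.1 h4)).symm

lemma lemB (q : ℂ) (r : ℝ) (hr : 0 < r) (hrq : (r : ℂ) = q) (hq1 : q ≠ 1)
    (s : ℤ) (f : ℤ → ℂ)
    (h : ∀ m n : ℤ, (q ^ n - q ^ m) * f (m + n)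
      = (1 - q ^ (m + s)) * (1 + q ^ n) * f m
        + (1 + q ^ m) * (q ^ (n + s) - 1) * f n) (k : ℤ) : f k = 0 := by
  have hq0 : q ≠ 0 := by rw [← hrq]; exact_mod_cast hr.ne'
  have hu0 : q ^ s ≠ 0 := zpow_ne_zero _ hq0
  have hpos := aq_pos_ne q r hr hrq
  have hinj := fun {m n : ℤ} => @aq_inj q r hr hrq hq1 m n
  have h1 : ∀ n, f n * (1 + q ^ n - 2 * q ^ n * q ^ s) = f 0 * (1 - q ^ s) * (1 + q ^ n) := by
    intro n
    have := h 0 n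
    simp only [zero_add, zpow_zero, zpow_add₀ hq0] at this
    linear_combination this
  have hf0 : f 0 = 0 := by
    by_cases hs : s = 0
    · subst hs
      have h2 : ∀ n, n ≠ 0 → f n = 0 := by
        intro n hn
        have h3 : 1 - q ^ n ≠ 0 := fun h => hn (hinj (by rw [zpow_zero]; linear_combination -h))
        apply mul_right_cancel₀ h3
        have := h1 n
        simp only [zpow_zero] at this
        linear_combination this
      have h3 := h 1 (-1)
      rw [h2 1 (by norm_num), h2 (-1) (by norm_num)] at h3
      simp only [mul_zero, add_zero, add_neg_cancel, mul_eq_zero] at h3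
      refine h3.resolve_left fun h => ?_
      have := hinj (sub_eq_zero.1 h)
      omega
    · have hu1 : 1 - q ^ s ≠ 0 := fun h => hs (hinj (by rw [zpow_zero]; linear_combination -h))
      have hA := h1 s
      have hC := h s (-s)
      simp only [zpow_add₀ hq0, zpow_neg, add_neg_cancel, neg_add_cancel, zpow_zero] at hA hC
      have p1 := hpos s 0 2 1 le_rfl (by norm_num) one_pos
      have p2 := hpos s 0 1 1 le_rfl (by norm_num) one_pos
      push_cast at p1 p2
      generalize q ^ s = u at *
      have hA' : f s * (1 + 2 * u) = f 0 * (1 + u) := by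
        apply mul_left_cancel₀ hu1; linear_combination hA
      field_simp at hC
      have hC' : f 0 = f s * (1 + u) := by
        apply mul_left_cancel₀ (mul_ne_zero hu1 p2); linear_combination hC
      have : f 0 * u ^ 2 = 0 := by
        linear_combination -(1 + 2 * u) * hC' - (1 + u) * hA'
      exact (mul_eq_zero.1 this).resolve_right (pow_ne_zero 2 hu0)
  by_contra hk
  have hk0 : k ≠ 0 := by rintro rfl; exact hk hf0
  have hz := fun n hn => special_unique q r hr hrq hq1 s f
    (by intro n; rw [h1, hf0]; ring) k n hk hn
  have hsp := h1 k
  rw [hf0, zero_mul, zero_mul, mul_eq_zero] at hsp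
  replace hsp := hsp.resolve_left hk
  obtain ⟨m, hm0, hmk⟩ : ∃ m : ℤ, m ≠ 0 ∧ m ≠ k :=
    ⟨|k| + 1, by positivity, by have := le_abs_self k; omega⟩
  have h3 := h m k
  rw [hz (m + k) (by omega), hz m hmk] at h3
  have p2 := hpos m 0 1 1 le_rfl (by norm_num) one_pos
  push_cast at p2
  have h4 : (0 * (q ^ m) ^ 2 + 1 * q ^ m + 1) * (q ^ (k + s) - 1) * f k = 0 := by
    linear_combination -h3
  simp only [mul_eq_zero, hk, p2, or_false, false_or] at h4
  rw [zpow_add₀ hq0] at h4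
  exact hk0 (hinj (by rw [zpow_zero]; linear_combination hsp + 2 * h4))

lemma bkA_single_single (q : ℂ) (i j : BIdx) (a b : ℂ) :
    bkA q (single i a) (single j b) = (a * b) • bk q i j := by
  unfold bkA
  rw [Finsupp.sum_single_index, Finsupp.sum_single_index] <;> simp

lemma bkA_add_left (q : ℂ) (x x' y : Aq) : bkA q (x + x') y = bkA q x y + bkA q x' y := by
  unfold bkA
  rw [Finsupp.sum_add_index']
  · simp
  · intro i a b
    simp only [add_mul, add_smul]
    exact Finsupp.sum_add

lemma bkA_add_right (q : ℂ) (x y y' : Aq) : bkA q x (y + y') = bkA q x y + bkA q x y' := by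
  unfold bkA
  rw [← Finsupp.sum_add]
  congr 1
  funext i a
  rw [Finsupp.sum_add_index']
  · simp
  · intro j b c
    simp only [mul_add, add_smul]

lemma alq_single (q : ℂ) (i : BIdx) (a : ℂ) : alq q (single i a) = single i (acoef q i * a) := by
  unfold alq; rw [Finsupp.sum_single_index]; simp

lemma DA_single (D : BIdx → Aq) (i : BIdx) (a : ℂ) : DA D (single i a) = a • D i := by
  unfold DA; rw [Finsupp.sum_single_index]; simp

lemma homOf_single (i : BIdx) : homOf i.parity (single i (1:ℂ)) := by
  intro j hj
  have := Finsupp.support_single_subset hj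
  simp at this
  rw [this]

/-- The derivation identity on basis elements `L m`, `X`. -/
lemma der_L (q : ℂ) (pD : Bool) (D : BIdx → Aq) (hder : IsAlphaDerivation q pD D)
    (m : ℤ) (j : BIdx) :
    DA D (bk q (.L m) j) = bkA q (D (.L m)) (single j (acoef q j))
      + bkA q (single (.L m) (1 + q ^ m)) (D j) := by
  have := hder _ _ _ _ (homOf_single (.L m)) (homOf_single j)
  simpa [bkA_single_single, alq_single, DA_single, BIdx.parity, sgn, acoef] using this

lemma mem_LI {x : Aq} {n : ℤ} (h : x ∈ spanLI n) :
    x = single (.L n) (x (.L n)) + single (.I n) (x (.I n)) := by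
  obtain ⟨a, b, rfl⟩ := Submodule.mem_span_pair.1 h
  simp

lemma mem_GT {x : Aq} {n : ℤ} (h : x ∈ spanGT n) :
    x = single (.G n) (x (.G n)) + single (.T n) (x (.T n)) := by
  obtain ⟨a, b, rfl⟩ := Submodule.mem_span_pair.1 h
  simp


lemma bk_eqs (q : ℂ) (m n : ℤ) :
    bk q (.L m) (.L n) = single (.L (m + n)) (qnum q m - qnum q n) ∧
    bk q (.L m) (.I n) = single (.I (m + n)) (-(qnum q n)) ∧
    bk q (.L m) (.G n) = single (.G (m + n)) (qnum q m - qnum q (n + 1)) ∧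
    bk q (.L m) (.T n) = single (.T (m + n)) (-(qnum q (n + 1))) ∧
    bk q (.I m) (.L n) = single (.I (m + n)) (qnum q m) ∧
    bk q (.G m) (.L n) = single (.G (m + n)) (qnum q (m + 1) - qnum q n) ∧
    bk q (.T m) (.L n) = single (.T (m + n)) (qnum q (m + 1)) :=
  ⟨rfl, rfl, rfl, rfl, rfl, rfl, rfl⟩

/-- Coordinates of `[x, c L_n]` and `[c L_m, x]` in the even and odd cases. -/
lemma coords_LI (q : ℂ) {x : Aq} {k : ℤ} (hx : x ∈ spanLI k) (n : ℤ) (c : ℂ) (N : ℤ)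
    (hN : N = k + n) :
    bkA q x (single (.L n) c) (.L N) = x (.L k) * c * (qnum q k - qnum q n) ∧
    bkA q x (single (.L n) c) (.I N) = x (.I k) * c * qnum q k ∧
    bkA q (single (.L n) c) x (.L N) = c * x (.L k) * (qnum q n - qnum q k) ∧
    bkA q (single (.L n) c) x (.I N) = c * x (.I k) * -qnum q k := by
  subst hN
  have e := mem_LI hx
  generalize x (.L k) = a at *
  generalize x (.I k) = b at *
  subst e
  simp [bkA_add_left, bkA_add_right, bkA_single_single, bk_eqs, add_comm n k]

lemma coords_GT (q : ℂ) {x : Aq} {k : ℤ} (hx : x ∈ spanGT k) (n : ℤ) (c : ℂ) (N : ℤ)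
    (hN : N = k + n) :
    bkA q x (single (.L n) c) (.G N) = x (.G k) * c * (qnum q (k + 1) - qnum q n) ∧
    bkA q x (single (.L n) c) (.T N) = x (.T k) * c * qnum q (k + 1) ∧
    bkA q (single (.L n) c) x (.G N) = c * x (.G k) * (qnum q n - qnum q (k + 1)) ∧
    bkA q (single (.L n) c) x (.T N) = c * x (.T k) * -qnum q (k + 1) := by
  subst hN
  have e := mem_GT hx
  generalize x (.G k) = a at *
  generalize x (.T k) = b at *
  subst e
  simp [bkA_add_left, bkA_add_right, bkA_single_single, bk_eqs, add_comm n k]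

lemma zero_of_LI {x : Aq} {n : ℤ} (h : x ∈ spanLI n) (h1 : x (.L n) = 0) (h2 : x (.I n) = 0) :
    x = 0 := by
  rw [mem_LI h, h1, h2]; simp

lemma zero_of_GT {x : Aq} {n : ℤ} (h : x ∈ spanGT n) (h1 : x (.G n) = 0) (h2 : x (.T n) = 0) :
    x = 0 := by
  rw [mem_GT h, h1, h2]; simp

lemma bkA_zero_left (q : ℂ) (y : Aq) : bkA q 0 y = 0 := by simp [bkA]

/-- The module part: once `D` kills all `L m`, the relation with `L` kills the other families.
`X` is a family with `[L_m, X_n] = t (q^(n+e) - q^(δ m)) X_{m+n}`. -/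
lemma module_part (q : ℂ) (r : ℝ) (hr : 0 < r) (hrq : (r : ℂ) = q) (hq1 : q ≠ 1)
    (pD : Bool) (s : ℤ) (D : BIdx → Aq) (hder : IsAlphaDerivation q pD D)
    (hL : ∀ m, D (.L m) = 0) (X : ℤ → BIdx) (e δ : ℤ) (hδ : 0 ≤ δ)
    (hX : ∀ m n, bk q (.L m) (X n)
      = single (X (m + n)) ((1 - q)⁻¹ * (q ^ (n + e) - q ^ (δ * m))))
    (hD : (∀ n, D (X n) ∈ spanLI (n + s)) ∨ (∀ n, D (X n) ∈ spanGT (n + s))) :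
    ∀ n, D (X n) = 0 := by
  have ht : (1 - q)⁻¹ ≠ 0 := inv_ne_zero (sub_ne_zero.2 hq1.symm)
  have key : ∀ m n, ((1 - q)⁻¹ * (q ^ (n + e) - q ^ (δ * m))) • D (X (m + n))
      = bkA q (single (.L m) (1 + q ^ m)) (D (X n)) := by
    intro m n
    have := der_L q pD D hder m (X n)
    rwa [hL, bkA_zero_left, zero_add, hX, DA_single] at this
  rcases hD with hD | hD
  · intro n
    refine zero_of_LI (hD n) ?_ ?_
    · refine lemC q r hr hrq hq1 e s δ 1 hδ (fun n => D (X n) (.L (n + s))) ?_ n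
      intro m n
      have h1 := DFunLike.congr_fun (key m n) (.L (m + n + s))
      rw [(coords_LI q (hD n) m _ _ (by ring)).2.2.1] at h1
      simp only [Finsupp.smul_apply, smul_eq_mul, qnum, div_eq_mul_inv, one_mul] at h1 ⊢
      apply mul_left_cancel₀ ht
      linear_combination h1
    · refine lemC q r hr hrq hq1 e s δ 0 hδ (fun n => D (X n) (.I (n + s))) ?_ n
      intro m n
      have h1 := DFunLike.congr_fun (key m n) (.I (m + n + s))
      rw [(coords_LI q (hD n) m _ _ (by ring)).2.2.2] at h1
      simp only [Finsupp.smul_apply, smul_eq_mul, qnum, div_eq_mul_inv, zero_mul, zpow_zero] at h1 ⊢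
      apply mul_left_cancel₀ ht
      linear_combination h1
  · intro n
    refine zero_of_GT (hD n) ?_ ?_
    · refine lemC q r hr hrq hq1 e (s + 1) δ 1 hδ (fun n => D (X n) (.G (n + s))) ?_ n
      intro m n
      have h1 := DFunLike.congr_fun (key m n) (.G (m + n + s))
      rw [(coords_GT q (hD n) m _ _ (by ring)).2.2.1] at h1
      simp only [Finsupp.smul_apply, smul_eq_mul, qnum, div_eq_mul_inv, one_mul, ← add_assoc] at h1 ⊢
      apply mul_left_cancel₀ ht
      linear_combination h1
    · refine lemC q r hr hrq hq1 e (s + 1) δ 0 hδ (fun n => D (X n) (.T (n + s))) ?_ n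
      intro m n
      have h1 := DFunLike.congr_fun (key m n) (.T (m + n + s))
      rw [(coords_GT q (hD n) m _ _ (by ring)).2.2.2] at h1
      simp only [Finsupp.smul_apply, smul_eq_mul, qnum, div_eq_mul_inv, zero_mul, zpow_zero,
        ← add_assoc] at h1 ⊢
      apply mul_left_cancel₀ ht
      linear_combination h1

lemma L_part (q : ℂ) (r : ℝ) (hr : 0 < r) (hrq : (r : ℂ) = q) (hq1 : q ≠ 1)
    (pD : Bool) (s : ℤ) (D : BIdx → Aq) (hder : IsAlphaDerivation q pD D)
    (hD : (∀ n, D (.L n) ∈ spanLI (n + s)) ∨ (∀ n, D (.L n) ∈ spanGT (n + s))) :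
    ∀ n, D (.L n) = 0 := by
  have ht : (1 - q)⁻¹ ≠ 0 := inv_ne_zero (sub_ne_zero.2 hq1.symm)
  have key : ∀ m n, (qnum q m - qnum q n) • D (.L (m + n))
      = bkA q (D (.L m)) (single (.L n) (1 + q ^ n))
        + bkA q (single (.L m) (1 + q ^ m)) (D (.L n)) := by
    intro m n
    have := der_L q pD D hder m (.L n)
    rwa [(bk_eqs q m n).1, DA_single] at this
  rcases hD with hD | hD
  · intro n
    refine zero_of_LI (hD n) ?_ ?_
    · refine lemA q r hr hrq hq1 s (fun n => D (.L n) (.L (n + s))) ?_ n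
      intro m n
      have h1 := DFunLike.congr_fun (key m n) (.L (m + n + s))
      rw [Finsupp.add_apply, (coords_LI q (hD n) m _ _ (by ring)).2.2.1,
        (coords_LI q (hD m) n _ _ (by ring)).1] at h1
      simp only [Finsupp.smul_apply, smul_eq_mul, qnum, div_eq_mul_inv] at h1 ⊢
      apply mul_left_cancel₀ ht
      linear_combination h1
    · refine lemB q r hr hrq hq1 s (fun n => D (.L n) (.I (n + s))) ?_ n
      intro m n
      have h1 := DFunLike.congr_fun (key m n) (.I (m + n + s))
      rw [Finsupp.add_apply, (coords_LI q (hD n) m _ _ (by ring)).2.2.2,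
        (coords_LI q (hD m) n _ _ (by ring)).2.1] at h1
      simp only [Finsupp.smul_apply, smul_eq_mul, qnum, div_eq_mul_inv] at h1 ⊢
      apply mul_left_cancel₀ ht
      linear_combination h1
  · intro n
    refine zero_of_GT (hD n) ?_ ?_
    · refine lemA q r hr hrq hq1 (s + 1) (fun n => D (.L n) (.G (n + s))) ?_ n
      intro m n
      have h1 := DFunLike.congr_fun (key m n) (.G (m + n + s))
      rw [Finsupp.add_apply, (coords_GT q (hD n) m _ _ (by ring)).2.2.1,
        (coords_GT q (hD m) n _ _ (by ring)).1] at h1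
      simp only [Finsupp.smul_apply, smul_eq_mul, qnum, div_eq_mul_inv, ← add_assoc] at h1 ⊢
      apply mul_left_cancel₀ ht
      linear_combination h1
    · refine lemB q r hr hrq hq1 (s + 1) (fun n => D (.L n) (.T (n + s))) ?_ n
      intro m n
      have h1 := DFunLike.congr_fun (key m n) (.T (m + n + s))
      rw [Finsupp.add_apply, (coords_GT q (hD n) m _ _ (by ring)).2.2.2,
        (coords_GT q (hD m) n _ _ (by ring)).2.1] at h1
      simp only [Finsupp.smul_apply, smul_eq_mul, qnum, div_eq_mul_inv, ← add_assoc] at h1 ⊢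
      apply mul_left_cancel₀ ht
      linear_combination h1

end helpers

/-- for `q` a positive real number, `q ≠ 1`, every homogeneous (even or odd)
`α_q`-derivation of `𝔄_q` of some degree `s ∈ ℤ` is identically zero. -/
theorem alpha_derivations_vanish
    (q : ℂ) (r : ℝ) (hr : 0 < r) (hrq : (r : ℂ) = q) (hq1 : q ≠ 1)
    (pD : Bool) (s : ℤ) (D : BIdx → Aq)
    (hhom : HomogeneousOfDegree pD s D) (hder : IsAlphaDerivation q pD D) :
    ∀ i : BIdx, D i = 0 := by
  have hLm : ∀ n, D (.L n) = 0 := by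
    apply L_part q r hr hrq hq1 pD s D hder
    cases pD
    · left; intro n; simpa using (hhom n).1
    · right; intro n; simpa using (hhom n).1
  intro i
  cases i with
  | L n => exact hLm n
  | I n =>
    refine module_part q r hr hrq hq1 pD s D hder hLm .I 0 0 le_rfl ?_ ?_ n
    · intro m n
      rw [(bk_eqs q m n).2.1, qnum, div_eq_mul_inv, add_zero, zero_mul, zpow_zero]
      congr 1; ring
    · cases pD
      · left; intro n; simpa using (hhom n).2.1
      · right; intro n; simpa using (hhom n).2.1
  | G n =>
    refine module_part q r hr hrq hq1 pD s D hder hLm .G 1 1 zero_le_one ?_ ?_ n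
    · intro m n
      rw [(bk_eqs q m n).2.2.1, qnum, qnum, div_eq_mul_inv, div_eq_mul_inv, one_mul]
      congr 1; ring
    · cases pD
      · right; intro n; simpa using (hhom n).2.2.1
      · left; intro n; simpa using (hhom n).2.2.1
  | T n =>
    refine module_part q r hr hrq hq1 pD s D hder hLm .T 1 0 le_rfl ?_ ?_ n
    · intro m n
      rw [(bk_eqs q m n).2.2.2.1, qnum, div_eq_mul_inv, zero_mul, zpow_zero]
      congr 1; ring
    · cases pD
      · right; intro n; simpa using (hhom n).2.2.2
      · left; intro n; simpa using (hhom n).2.2.2
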